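/- arXiv:2004.14102 — 2 statements merged into one kernel-verified Lean document; each statement's English description precedes it below -/
import Mathlib

section
/- Let G be a finite simple graph and let T₁,…,T_k (k ≥ 1) be pairwise disjoint nonempty subsets of V(G) with T₁ ∪ … ∪ T_k = V(G), such that for all i ≠ j, every vertex of T_i has strictly more than |T_j|/2 neighbours in T_j. Then every minimum Steiner forest for (G; T₁,…,T_k) has at most one special connected component, i.e., at most one connected component that contains a trivial terminal set and has rank greater than 1. -/
/-- A Steiner forest for `(G; T₁, …, T_k)`: a subgraph of `G` that is a forest (acyclic) in
which, for each `i`, all vertices of `T i` lie in the same connected component. -/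
def IsSteinerForest {V : Type*} (G : SimpleGraph V) {k : ℕ} (T : Fin k → Finset V)
    (F : SimpleGraph V) : Prop :=
  F ≤ G ∧ F.IsAcyclic ∧ ∀ i : Fin k, ∀ u ∈ T i, ∀ v ∈ T i, F.Reachable u v

/-- The rank of a connected component `C` of a forest `F`: the number of indices `i` such
that `C` contains a vertex of `T i`. -/
noncomputable def compRank {V : Type*} {k : ℕ} (T : Fin k → Finset V) (F : SimpleGraph V)
    (C : F.ConnectedComponent) : ℕ :=
  {i : Fin k | ∃ v ∈ T i, F.connectedComponentMk v = C}.ncard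

/-- A component is special if it contains all vertices of some trivial terminal set
(one inducing a connected subgraph of `G`) and has rank greater than `1`. -/
noncomputable def IsSpecialComp {V : Type*} (G : SimpleGraph V) {k : ℕ}
    (T : Fin k → Finset V) (F : SimpleGraph V) (C : F.ConnectedComponent) : Prop :=
  (∃ i : Fin k, (G.induce ((T i : Set V))).Connected ∧
      ∀ v ∈ T i, F.connectedComponentMk v = C) ∧
    1 < compRank T F C

open Classical in
/-- A forest on a finite vertex set has as many vertices as edges and components together. -/
theorem SimpleGraph.IsAcyclic.ncard_edgeSet_add_card_connectedComponent {V : Type*} [Fintype V]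
    {F : SimpleGraph V} (hF : F.IsAcyclic) :
    F.edgeSet.ncard + Fintype.card F.ConnectedComponent = Fintype.card V := by
  have hdeg (C : F.ConnectedComponent) :
      ∑ v : {v // F.connectedComponentMk v = C}, F.degree v + 2 =
        2 * Fintype.card {v // F.connectedComponentMk v = C} := by
    have htree : (F.induce {v | F.connectedComponentMk v = C}).IsTree :=
      hF.isTree_connectedComponent C
    have hcard := htree.card_edgeFinset
    have hsum := (F.induce {v | F.connectedComponentMk v = C}).sum_degrees_eq_twice_card_edges
    have hsame : ∑ v : {v // F.connectedComponentMk v = C}, F.degree v =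
        ∑ v : {v | F.connectedComponentMk v = C},
          (F.induce {v | F.connectedComponentMk v = C}).degree v := by
      refine Finset.sum_congr rfl fun v _ => ?_
      refine (SimpleGraph.degree_induce_of_neighborSet_subset ?_).symm
      intro w hw
      exact (SimpleGraph.ConnectedComponent.sound (SimpleGraph.Adj.reachable hw)).symm.trans v.2
    rw [hsame, hsum]
    change _ + 1 = Fintype.card {v // F.connectedComponentMk v = C} at hcard
    omega
  have hfib (f : V → ℕ) : ∑ v, f v =
      ∑ C : F.ConnectedComponent, ∑ v : {v // F.connectedComponentMk v = C}, f v := by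
    rw [← (Equiv.sigmaFiberEquiv F.connectedComponentMk).sum_comp, Fintype.sum_sigma]
    rfl
  have hV : Fintype.card V =
      ∑ C : F.ConnectedComponent, Fintype.card {v // F.connectedComponentMk v = C} := by
    have := hfib fun _ => 1
    simpa using this
  have hE := F.sum_degrees_eq_twice_card_edges
  have htotal := Finset.sum_congr (rfl : (Finset.univ : Finset F.ConnectedComponent) = _)
    fun C _ => hdeg C
  rw [Finset.sum_add_distrib, ← hfib fun v => F.degree v, hE, ← Finset.mul_sum, ← hV] at htotal
  rw [Finset.sum_const, Finset.card_univ, smul_eq_mul] at htotal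
  rw [← SimpleGraph.coe_edgeFinset, Set.ncard_coe_finset]
  omega

/-- Delete from `G` all edges joining vertices with different labels. -/
def SimpleGraph.monochromatic {V β : Type*} (G : SimpleGraph V) (c : V → β) : SimpleGraph V where
  Adj u v := G.Adj u v ∧ c u = c v
  symm := ⟨fun _ _ h => ⟨h.1.symm, h.2.symm⟩⟩
  loopless := ⟨fun _ h => G.irrefl h.1⟩

theorem SimpleGraph.Reachable.monochromatic_eq {V β : Type*} {G : SimpleGraph V} {c : V → β}
    {u v : V} (h : (G.monochromatic c).Reachable u v) : c u = c v := by
  obtain ⟨p⟩ := h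
  induction p with
  | nil => rfl
  | cons h _ ih => exact h.2.trans ih

open Classical in
/-- If the vertices can be labelled so that each terminal set is connected by edges between
equally labelled vertices, then a minimum Steiner forest has at least as many components as
there are labels. -/
theorem card_label_le_card_connectedComponent {V β : Type*} [Fintype V] [Fintype β]
    {G : SimpleGraph V} {k : ℕ} {T : Fin k → Finset V} {F : SimpleGraph V} (hF : F.IsAcyclic)
    (hmin : ∀ F' : SimpleGraph V, IsSteinerForest G T F' → F.edgeSet.ncard ≤ F'.edgeSet.ncard)
    {c : V → β} (hc : Function.Surjective c)
    (hT : ∀ i, ∀ u ∈ T i, ∀ v ∈ T i, (G.monochromatic c).Reachable u v) :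
    Nat.card β ≤ Nat.card F.ConnectedComponent := by
  rw [Nat.card_eq_fintype_card, Nat.card_eq_fintype_card]
  obtain ⟨F', hle, hacyc, hreach⟩ := (G.monochromatic c).exists_isAcyclic_reachable_eq_le
  have hle' := hmin F' ⟨hle.trans fun _ _ h => h.1, hacyc, fun i u hu v hv => by
    rw [hreach]; exact hT i u hu v hv⟩
  have hlabels : Fintype.card β ≤ Fintype.card F'.ConnectedComponent := by
    refine Fintype.card_le_of_surjective
      (SimpleGraph.ConnectedComponent.lift c fun u v p _ =>
        (hreach ▸ p.reachable : (G.monochromatic c).Reachable u v).monochromatic_eq) fun b => ?_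
    obtain ⟨v, rfl⟩ := hc b
    exact ⟨F'.connectedComponentMk v, rfl⟩
  have h₁ := hF.ncard_edgeSet_add_card_connectedComponent
  have h₂ := hacyc.ncard_edgeSet_add_card_connectedComponent
  omega

/-- Two vertices each adjacent to more than half of `S` have a common neighbour in `S`. -/
theorem SimpleGraph.exists_common_neighbor {V : Type*} [DecidableEq V] (G : SimpleGraph V)
    [DecidableRel G.Adj] {S : Finset V} {u v : V}
    (hu : (S.card : ℝ) / 2 < ((S.filter (fun w => G.Adj u w)).card : ℝ))
    (hv : (S.card : ℝ) / 2 < ((S.filter (fun w => G.Adj v w)).card : ℝ)) :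
    ∃ w ∈ S, G.Adj u w ∧ G.Adj v w := by
  have hsum : S.card <
      (S.filter (fun w => G.Adj u w)).card + (S.filter (fun w => G.Adj v w)).card := by
    have : (S.card : ℝ) <
      (S.filter (fun w => G.Adj u w)).card + (S.filter (fun w => G.Adj v w)).card := by linarith
    exact_mod_cast this
  obtain ⟨w, hw⟩ := Finset.inter_nonempty_of_card_lt_card_add_card
    (Finset.filter_subset _ _) (Finset.filter_subset _ _) hsum
  simp only [Finset.mem_inter, Finset.mem_filter] at hw
  exact ⟨w, hw.1.1, hw.1.2, hw.2.2⟩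

theorem SimpleGraph.Connected.monochromatic_reachable {V β : Type*} {G : SimpleGraph V}
    {c : V → β} {S : Set V} (hS : (G.induce S).Connected) {b : β} (hc : ∀ v ∈ S, c v = b)
    {u v : V} (hu : u ∈ S) (hv : v ∈ S) : (G.monochromatic c).Reachable u v :=
  (hS.preconnected ⟨u, hu⟩ ⟨v, hv⟩).map
    (⟨Subtype.val, fun {x y} h => ⟨h, (hc x x.2).trans (hc y y.2).symm⟩⟩ :
      G.induce S →g G.monochromatic c)

/-- For a pairwise `(> 1/2)`-dense instance of Steiner forest without Steiner
nodes (the disjoint nonempty terminal sets cover `V(G)`, and every vertex of `T i` has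
strictly more than `|T j|/2` neighbours in every other `T j`), every minimum Steiner forest
has at most one special connected component. -/
theorem dense_steiner_forest_at_most_one_special {V : Type*} [Fintype V] [DecidableEq V]
    (G : SimpleGraph V) [DecidableRel G.Adj]
    {k : ℕ} (hk : 1 ≤ k) (T : Fin k → Finset V)
    (hdisj : ∀ i j, i ≠ j → Disjoint (T i) (T j))
    (hne : ∀ i, (T i).Nonempty)
    (hcover : Finset.univ.biUnion T = (Finset.univ : Finset V))
    (hdense : ∀ i j, i ≠ j → ∀ v ∈ T i,
      ((T j).card : ℝ) / 2 < (((T j).filter (fun w => G.Adj v w)).card : ℝ)) :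
    ∀ F : SimpleGraph V, IsSteinerForest G T F →
      (∀ F' : SimpleGraph V, IsSteinerForest G T F' → F.edgeSet.ncard ≤ F'.edgeSet.ncard) →
      {C : F.ConnectedComponent | IsSpecialComp G T F C}.Subsingleton := by
  classical
  rintro F ⟨hle, hacyc, hreach⟩ hmin A ⟨⟨a, haconn, haA⟩, hArank⟩ B ⟨⟨b, hbconn, hbB⟩, hBrank⟩
  by_contra hAB
  have hother {C : F.ConnectedComponent} (hC : 1 < compRank T F C) (i : Fin k) :
      ∃ j ≠ i, ∀ v ∈ T j, F.connectedComponentMk v = C := by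
    obtain ⟨j, ⟨w, hw, hwC⟩, hj⟩ := Set.exists_ne_of_one_lt_ncard hC i
    exact ⟨j, hj, fun v hv =>
      (SimpleGraph.ConnectedComponent.sound (hreach j v hv w hw)).trans hwC⟩
  obtain ⟨a', ha', ha'A⟩ := hother hArank a
  obtain ⟨b', hb', hb'B⟩ := hother hBrank b
  have hsep {i j : Fin k} {C D : F.ConnectedComponent} (hCD : C ≠ D)
      (hi : ∀ v ∈ T i, F.connectedComponentMk v = C)
      (hj : ∀ v ∈ T j, F.connectedComponentMk v = D) : i ≠ j := by
    rintro rfl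
    obtain ⟨v, hv⟩ := hne i
    exact hCD ((hi v hv).symm.trans (hj v hv))
  have hnot {i j : Fin k} (hij : i ≠ j) {v : V} (hv : v ∈ T i) : v ∉ T j :=
    Finset.disjoint_left.1 (hdisj i j hij) hv
  let c : V → Option F.ConnectedComponent := fun v =>
    if v ∈ T a then none else if v ∈ T b then some B else
      if F.connectedComponentMk v = B then some A else some (F.connectedComponentMk v)
  have hca {v : V} (hv : v ∈ T a) : c v = none := if_pos hv
  have hcb {v : V} (hv : v ∈ T b) : c v = some B := by
    simp only [c, if_neg (hnot (hsep (Ne.symm hAB) hbB haA) hv), if_pos hv]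
  have hcA {v : V} (ha : v ∉ T a) (hb : v ∉ T b) (hv : F.connectedComponentMk v = A ∨
      F.connectedComponentMk v = B) : c v = some A := by
    rcases hv with hv | hv <;> simp [c, ha, hb, hv]
  have hcC {v : V} (hA : F.connectedComponentMk v ≠ A) (hB : F.connectedComponentMk v ≠ B) :
      c v = some (F.connectedComponentMk v) := by
    simp only [c, if_neg (fun h => hA (haA v h)), if_neg (fun h => hB (hbB v h)), if_neg hB]
  have hca' {v : V} (hv : v ∈ T a') : c v = some A :=
    hcA (hnot ha' hv) (hnot (hsep hAB ha'A hbB) hv) (.inl (ha'A v hv))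
  have hcb' {v : V} (hv : v ∈ T b') : c v = some A :=
    hcA (hnot (hsep (Ne.symm hAB) hb'B haA) hv) (hnot hb' hv) (.inr (hb'B v hv))
  have hsurj : Function.Surjective c := by
    rintro (_ | C)
    · exact (hne a).imp fun v hv => hca hv
    · by_cases hCB : C = B
      · exact (hne b).imp fun v hv => (hcb hv).trans (congrArg some hCB.symm)
      by_cases hCA : C = A
      · exact (hne a').imp fun v hv => (hca' hv).trans (congrArg some hCA.symm)
      obtain ⟨v, rfl⟩ := C.exists_rep
      exact ⟨v, hcC hCA hCB⟩
  have hcommon {i j : Fin k} (hij : i ≠ j) (hi : ∀ v ∈ T i, c v = some A)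
      (hj : ∀ v ∈ T j, c v = some A) {u v : V} (hu : u ∈ T i) (hv : v ∈ T i) :
      (G.monochromatic c).Reachable u v := by
    obtain ⟨w, hw, huw, hvw⟩ :=
      G.exists_common_neighbor (hdense i j hij u hu) (hdense i j hij v hv)
    have h₁ : (G.monochromatic c).Adj u w := ⟨huw, (hi u hu).trans (hj w hw).symm⟩
    have h₂ : (G.monochromatic c).Adj v w := ⟨hvw, (hi v hv).trans (hj w hw).symm⟩
    exact h₁.reachable.trans h₂.reachable.symm
  have hT (i : Fin k) (u : V) (hu : u ∈ T i) (v : V) (hv : v ∈ T i) :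
      (G.monochromatic c).Reachable u v := by
    have hsame (w : V) (hw : w ∈ T i) : F.connectedComponentMk w = F.connectedComponentMk u :=
      SimpleGraph.ConnectedComponent.sound (hreach i w hw u hu)
    by_cases hia : i = a
    · subst hia
      exact haconn.monochromatic_reachable (fun v hv => hca hv) hu hv
    by_cases hib : i = b
    · subst hib
      exact hbconn.monochromatic_reachable (fun v hv => hcb hv) hu hv
    by_cases hA : F.connectedComponentMk u = A
    · exact hcommon (hsep hAB (fun w hw => (hsame w hw).trans hA) hb'B)
        (fun w hw => hcA (hnot hia hw) (hnot hib hw) (.inl ((hsame w hw).trans hA)))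
        (fun w hw => hcb' hw) hu hv
    by_cases hB : F.connectedComponentMk u = B
    · exact hcommon (hsep (Ne.symm hAB) (fun w hw => (hsame w hw).trans hB) ha'A)
        (fun w hw => hcA (hnot hia hw) (hnot hib hw) (.inr ((hsame w hw).trans hB)))
        (fun w hw => hca' hw) hu hv
    obtain ⟨p⟩ := hreach i u hu v hv
    clear hsame hu hv
    induction p with
    | nil => rfl
    | @cons x y z h p ih =>
      have hxy : F.connectedComponentMk x = F.connectedComponentMk y :=
        SimpleGraph.ConnectedComponent.sound h.reachable
      have hadj : (G.monochromatic c).Adj x y :=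
        ⟨hle h, by rw [hcC hA hB, hcC (hxy ▸ hA) (hxy ▸ hB), hxy]⟩
      exact hadj.reachable.trans (ih (hxy ▸ hA) (hxy ▸ hB))
  have hcard := card_label_le_card_connectedComponent hacyc hmin hsurj hT
  rw [Finite.card_option] at hcard
  omega
end

section
/- Let G be a finite simple graph and let T₁,…,T_k (k ≥ 1) be pairwise disjoint nonempty subsets of V(G) with T₁ ∪ … ∪ T_k = V(G), such that for all i ≠ j, every vertex of T_i has at least |T_j|/2 neighbours in T_j, and assume at least one Steiner forest for (G; T₁,…,T_k) exists. Then there exists a minimum Steiner forest with at most one special connected component, i.e., at most one connected component that contains a trivial terminal set and has rank greater than 1. -/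
namespace SimpleGraph

variable {V : Type*}

open scoped Classical in
theorem ConnectedComponent.degree_toSimpleGraph [Fintype V] {F : SimpleGraph V}
    (C : F.ConnectedComponent) (v : C) : C.toSimpleGraph.degree v = F.degree v := by
  rw [← card_neighborFinset_eq_degree, ← card_neighborFinset_eq_degree]
  refine Finset.card_bij (fun w _ => (w : V)) ?_ (fun _ _ _ _ h => Subtype.ext h) ?_
  · intro w hw
    rw [mem_neighborFinset] at hw ⊢
    exact C.toSimpleGraph_hom.map_adj hw
  · intro w hw
    rw [mem_neighborFinset] at hw
    have hwC : w ∈ C := (C.mem_supp_congr_adj hw).1 v.2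
    exact ⟨⟨w, hwC⟩, by rw [mem_neighborFinset]; exact hw, rfl⟩

/-- A finite forest has as many edges as it has vertices minus connected components. -/
theorem IsAcyclic.ncard_edgeSet_add_card_connectedComponent_s11 [Finite V] {F : SimpleGraph V}
    (hF : F.IsAcyclic) :
    F.edgeSet.ncard + Nat.card F.ConnectedComponent = Nat.card V := by
  classical
  have := Fintype.ofFinite V
  have htree (C : F.ConnectedComponent) :
      ∑ v : C, F.degree v + 2 = 2 * Fintype.card C := by
    rw [← (hF.isTree_connectedComponent C).card_edgeFinset, mul_add,
      ← sum_degrees_eq_twice_card_edges]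
    simp only [C.degree_toSimpleGraph, mul_one]
  have hsigma : ∑ C : F.ConnectedComponent, ∑ v : C, F.degree v = ∑ v, F.degree v := by
    rw [← Fintype.sum_sigma']
    exact Fintype.sum_equiv (Equiv.sigmaFiberEquiv F.connectedComponentMk) _ _ fun _ => rfl
  have hcard : ∑ C : F.ConnectedComponent, Fintype.card C = Fintype.card V := by
    rw [← Fintype.card_sigma]
    exact Fintype.card_congr (Equiv.sigmaFiberEquiv F.connectedComponentMk)
  have hsum := Finset.sum_congr (rfl : Finset.univ = Finset.univ) fun C _ => htree C
  rw [Finset.sum_add_distrib, ← Finset.mul_sum, hsigma, hcard,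
    sum_degrees_eq_twice_card_edges] at hsum
  simp only [Finset.sum_const, Finset.card_univ, smul_eq_mul] at hsum
  rw [← coe_edgeFinset, Set.ncard_coe_finset, Nat.card_eq_fintype_card, Nat.card_eq_fintype_card]
  lia

/-- A surjective labelling whose fibres are the connected components counts the components. -/
theorem card_connectedComponent_eq_of_reachable_iff {ι : Type*} {F : SimpleGraph V} {g : V → ι}
    (hg : Function.Surjective g) (h : ∀ u v, F.Reachable u v ↔ g u = g v) :
    Nat.card F.ConnectedComponent = Nat.card ι := by
  refine Nat.card_congr (Equiv.ofBijective
    (fun C : F.ConnectedComponent => C.lift g fun u v p _ => (h u v).1 p.reachable) ⟨?_, ?_⟩)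
  · intro C D
    induction C using ConnectedComponent.ind
    induction D using ConnectedComponent.ind
    exact fun e => ConnectedComponent.sound ((h _ _).2 e)
  · exact fun i => (hg i).imp' F.connectedComponentMk fun _ e => e

end SimpleGraph

theorem exists_isSteinerForest_minimal {V : Type*} {G : SimpleGraph V} {k : ℕ}
    {T : Fin k → Finset V} (hex : ∃ F, IsSteinerForest G T F) :
    ∃ F, IsSteinerForest G T F ∧
      ∀ F', IsSteinerForest G T F' → F.edgeSet.ncard ≤ F'.edgeSet.ncard :=
  exists_minimalFor_of_wellFoundedLT _ (fun F : SimpleGraph V => F.edgeSet.ncard) hex |>.imp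
    fun _ h => ⟨h.1, fun _ hF' => (le_total _ _).elim id fun hle => h.2 hF' hle⟩

open SimpleGraph in
/-- Keeping one trivial terminal set in each special component and moving all their other
terminal sets to a single special component preserves the number of components. -/
theorem exists_isSteinerForest_special_subsingleton {V : Type*} [Finite V] {G : SimpleGraph V}
    {k : ℕ} {T : Fin k → Finset V} (hdisj : ∀ i j, i ≠ j → Disjoint (T i) (T j))
    (hne : ∀ i, (T i).Nonempty) (hcover : ∀ v, ∃ i, v ∈ T i)
    (hadj : ∀ i j, i ≠ j → ∀ v ∈ T i, ∃ w ∈ T j, G.Adj v w)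
    {F : SimpleGraph V} (hF : IsSteinerForest G T F) :
    ∃ F' : SimpleGraph V, IsSteinerForest G T F' ∧ F'.edgeSet.ncard = F.edgeSet.ncard ∧
      {C : F'.ConnectedComponent | IsSpecialComp G T F' C}.Subsingleton := by
  classical
  by_cases hS : {C | IsSpecialComp G T F C}.Subsingleton
  · exact ⟨F, hF, rfl, hS⟩
  obtain ⟨C₀, hC₀, -⟩ := Set.not_subsingleton_iff.1 hS
  obtain ⟨hFG, hFa, hFT⟩ := hF
  choose idx hidx using hcover
  have hidx_eq {i v} (hv : v ∈ T i) : idx v = i := by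
    by_contra h
    exact Finset.disjoint_left.1 (hdisj _ _ h) (hidx v) hv
  have hcomp (C : F.ConnectedComponent) : ∃ i, IsSpecialComp G T F C →
      (G.induce (T i : Set V)).Connected ∧ ∀ v ∈ T i, F.connectedComponentMk v = C := by
    by_cases hC : IsSpecialComp G T F C
    · exact hC.1.imp fun i hi _ => hi
    · obtain ⟨v, -⟩ := C.exists_rep
      exact ⟨idx v, fun h => (hC h).elim⟩
  choose t ht using hcomp
  let mk := F.connectedComponentMk
  let g (v : V) : F.ConnectedComponent :=
    if IsSpecialComp G T F (mk v) ∧ idx v ≠ t (mk v) then C₀ else mk v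
  have hg_ordinary {v} (h : ¬ IsSpecialComp G T F (mk v)) : g v = mk v := if_neg fun h' => h h'.1
  have hg_core {C v} (hC : IsSpecialComp G T F C) (hv : v ∈ T (t C)) : g v = C := by
    have hmk : mk v = C := (ht C hC).2 v hv
    have : idx v = t (mk v) := by rw [hmk, hidx_eq hv]
    simp only [g, this, ne_eq, not_true_eq_false, and_false, if_false, hmk]
  have hg_special {v} (h : IsSpecialComp G T F (g v)) (h₀ : g v ≠ C₀) : v ∈ T (t (g v)) := by
    by_cases hc : IsSpecialComp G T F (mk v) ∧ idx v ≠ t (mk v)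
    · exact (h₀ (if_pos hc)).elim
    · have hgv : g v = mk v := if_neg hc
      rw [hgv] at h ⊢
      have : idx v = t (mk v) := by tauto
      exact this ▸ hidx v
  have hg_nonspecial {v} (h : ¬ IsSpecialComp G T F (g v)) :
      ¬ IsSpecialComp G T F (mk v) := by
    intro hs
    by_cases hc : IsSpecialComp G T F (mk v) ∧ idx v ≠ t (mk v)
    · exact h (by rw [show g v = C₀ from if_pos hc]; exact hC₀)
    · exact h (by rw [show g v = mk v from if_neg hc]; exact hs)
  have hgT {i u v} (hu : u ∈ T i) (hv : v ∈ T i) : g u = g v := by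
    have : mk u = mk v := ConnectedComponent.sound (hFT i u hu v hv)
    simp only [g, hidx_eq hu, hidx_eq hv, this]
  have hg_surj : Function.Surjective g := by
    intro C
    by_cases hC : IsSpecialComp G T F C
    · obtain ⟨v, hv⟩ := hne (t C)
      exact ⟨v, hg_core hC hv⟩
    · obtain ⟨v, rfl⟩ := C.exists_rep
      exact ⟨v, hg_ordinary hC⟩
  let H : SimpleGraph V :=
    { Adj := fun u v => G.Adj u v ∧ g u = g v
      symm := ⟨fun _ _ h => ⟨h.1.symm, h.2.symm⟩⟩
      loopless := ⟨fun _ h => h.1.ne rfl⟩ }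
  have hH_label {u v} (h : H.Reachable u v) : g u = g v := by
    obtain ⟨p⟩ := h
    induction p with
    | nil => rfl
    | cons h _ ih => exact h.2.trans ih
  have hH_core {C u v} (hC : IsSpecialComp G T F C) (hu : u ∈ T (t C)) (hv : v ∈ T (t C)) :
      H.Reachable u v := by
    let φ : G.induce (T (t C) : Set V) →g H :=
      { toFun := fun w => w
        map_rel' := fun {a b} h => ⟨h, hgT a.2 b.2⟩ }
    exact ((ht C hC).1.preconnected ⟨u, hu⟩ ⟨v, hv⟩).map φ
  have hH_to_core {u} (hu : g u = C₀) : ∃ w ∈ T (t C₀), H.Reachable u w := by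
    by_cases h : idx u = t C₀
    · exact ⟨u, h ▸ hidx u, .rfl⟩
    · obtain ⟨w, hw, huw⟩ := hadj _ _ h u (hidx u)
      exact ⟨w, hw, Adj.reachable (G := H) ⟨huw, hu.trans (hg_core hC₀ hw).symm⟩⟩
  have hH_ordinary {u v} (h : F.Reachable u v) (hu : ¬ IsSpecialComp G T F (mk u)) :
      H.Reachable u v := by
    obtain ⟨p⟩ := h
    induction p with
    | nil => exact .rfl
    | @cons a b _ hab _ ih =>
      have hmk : mk a = mk b := ConnectedComponent.sound hab.reachable
      have hb := hmk ▸ hu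
      exact (Adj.reachable (G := H)
        ⟨hFG hab, by rw [hg_ordinary hu, hg_ordinary hb, hmk]⟩).trans (ih hb)
  have hH_iff (u v : V) : H.Reachable u v ↔ g u = g v := by
    refine ⟨hH_label, fun h => ?_⟩
    by_cases h₀ : g u = C₀
    · obtain ⟨a, ha, hua⟩ := hH_to_core h₀
      obtain ⟨b, hb, hvb⟩ := hH_to_core (h ▸ h₀)
      exact hua.trans ((hH_core hC₀ ha hb).trans hvb.symm)
    by_cases hs : IsSpecialComp G T F (g u)
    · have hv := hg_special (v := v) (h ▸ hs) (h ▸ h₀)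
      exact hH_core hs (hg_special hs h₀) (h ▸ hv)
    · have hu := hg_nonspecial hs
      have hv := hg_nonspecial (v := v) (h ▸ hs)
      rw [hg_ordinary hu, hg_ordinary hv] at h
      exact hH_ordinary (ConnectedComponent.exact h) hu
  obtain ⟨F', hF'H, hF'a, hF'r⟩ := H.exists_isAcyclic_reachable_eq_le
  have hF'_iff (u v : V) : F'.Reachable u v ↔ g u = g v := hF'r ▸ hH_iff u v
  have hF'_special {v} (h : IsSpecialComp G T F' (F'.connectedComponentMk v)) : g v = C₀ := by
    obtain ⟨⟨i, hi, hiv⟩, hrank⟩ := h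
    obtain ⟨a, ⟨x, hxa, hxv⟩, b, ⟨y, hyb, hyv⟩, hab⟩ := Set.one_lt_ncard_iff_nontrivial.1 hrank
    have label {w} (hw : F'.connectedComponentMk w = F'.connectedComponentMk v) : g w = g v :=
      (hF'_iff _ _).1 (ConnectedComponent.exact hw)
    by_contra h₀
    by_cases hs : IsSpecialComp G T F (g v)
    · have mem_core {w} (hw : g w = g v) : w ∈ T (t (g v)) := by
        rw [← hw] at h₀ hs ⊢
        exact hg_special hs h₀
      exact hab (by
        rw [← hidx_eq hxa, ← hidx_eq hyb, hidx_eq (mem_core (label hxv)),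
          hidx_eq (mem_core (label hyv))])
    · have mk_eq {w} (hw : F'.connectedComponentMk w = F'.connectedComponentMk v) :
          mk w = g v := by
        rw [← label hw] at hs ⊢
        exact (hg_ordinary (hg_nonspecial hs)).symm
      exact hs ⟨⟨i, hi, fun w hw => mk_eq (hiv w hw)⟩, Set.one_lt_ncard_iff_nontrivial.2
        ⟨a, ⟨x, hxa, mk_eq hxv⟩, b, ⟨y, hyb, mk_eq hyv⟩, hab⟩⟩
  refine ⟨F', ⟨fun _ _ h => (hF'H h).1, hF'a, fun i u hu v hv => (hF'_iff u v).2 (hgT hu hv)⟩,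
    ?_, ?_⟩
  · have h₁ := hFa.ncard_edgeSet_add_card_connectedComponent_s11
    have h₂ := hF'a.ncard_edgeSet_add_card_connectedComponent_s11
    rw [card_connectedComponent_eq_of_reachable_iff hg_surj hF'_iff] at h₂
    lia
  · intro C hC D hD
    induction C using ConnectedComponent.ind
    induction D using ConnectedComponent.ind
    exact ConnectedComponent.sound
      ((hF'_iff _ _).2 ((hF'_special hC).trans (hF'_special hD).symm))

/-- For a pairwise `1/2`-dense instance of Steiner forest without Steiner
nodes (the disjoint nonempty terminal sets cover `V(G)`, and every vertex of `T i` has at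
least `|T j|/2` neighbours in every other `T j`), if some Steiner forest exists then there
is a minimum Steiner forest with at most one special connected component. -/
theorem half_dense_steiner_forest_one_special {V : Type*} [Fintype V] [DecidableEq V]
    (G : SimpleGraph V) [DecidableRel G.Adj]
    {k : ℕ} (hk : 1 ≤ k) (T : Fin k → Finset V)
    (hdisj : ∀ i j, i ≠ j → Disjoint (T i) (T j))
    (hne : ∀ i, (T i).Nonempty)
    (hcover : Finset.univ.biUnion T = (Finset.univ : Finset V))
    (hdense : ∀ i j, i ≠ j → ∀ v ∈ T i,
      ((T j).card : ℝ) / 2 ≤ (((T j).filter (fun w => G.Adj v w)).card : ℝ))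
    (hex : ∃ F, IsSteinerForest G T F) :
    ∃ F : SimpleGraph V, IsSteinerForest G T F ∧
      (∀ F' : SimpleGraph V, IsSteinerForest G T F' → F.edgeSet.ncard ≤ F'.edgeSet.ncard) ∧
      {C : F.ConnectedComponent | IsSpecialComp G T F C}.Subsingleton := by
  obtain ⟨F, hF, hmin⟩ := exists_isSteinerForest_minimal hex
  have hcover' (v : V) : ∃ i, v ∈ T i := by
    simpa using hcover.ge (Finset.mem_univ v)
  have hadj (i j : Fin k) (hij : i ≠ j) (v : V) (hv : v ∈ T i) : ∃ w ∈ T j, G.Adj v w := by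
    have hpos : (0 : ℝ) < (T j).card := by exact_mod_cast (hne j).card_pos
    have hfilter : (0 : ℝ) < ((T j).filter (fun w => G.Adj v w)).card :=
      (half_pos hpos).trans_le (hdense i j hij v hv)
    obtain ⟨w, hw⟩ := Finset.card_pos.1 (by exact_mod_cast hfilter)
    exact ⟨w, Finset.mem_filter.1 hw⟩
  obtain ⟨F', hF', hcard, hsub⟩ :=
    exists_isSteinerForest_special_subsingleton hdisj hne hcover' hadj hF
  exact ⟨F', hF', fun F'' h => hcard ▸ hmin F'' h, hsub⟩
end
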